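/- arXiv:1602.03934 — 9 statements merged into one kernel-verified Lean document; each statement's English description precedes it below -/
import Mathlib

section
/- Let f010 : ℕ → ℕ satisfy f010(0)=0, f010(1)=1, f010(2)=3, and f010(n)=3·f010(n−2)+4 for all n ≥ 3. Then for every odd n ≥ 1, f010(n) = 3^((n+1)/2) − 2. -/
theorem f010_odd_closed_form (f010 : ℕ → ℕ)
    (h0 : f010 0 = 0) (h1 : f010 1 = 1) (h2 : f010 2 = 3)
    (hrec : ∀ n : ℕ, 3 ≤ n → f010 n = 3 * f010 (n - 2) + 4) :
    ∀ n : ℕ, Odd n → 1 ≤ n → f010 n = 3 ^ ((n + 1) / 2) - 2 := by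
  have key : ∀ k : ℕ, f010 (2 * k + 1) + 2 = 3 ^ (k + 1) := by
    intro k
    induction k with
    | zero => simp [h1]
    | succ k ih =>
      have h := hrec (2 * (k + 1) + 1) (by omega)
      rw [show 2 * (k + 1) + 1 - 2 = 2 * k + 1 by omega] at h
      rw [h, pow_succ, ← ih]
      ring
  rintro n ⟨k, rfl⟩ -
  rw [show (2 * k + 1 + 1) / 2 = k + 1 by omega, ← key k, Nat.add_sub_cancel]
end

section
/- Let f010 : ℕ → ℕ satisfy f010(0)=0, f010(1)=1, f010(2)=3, and f010(n)=3·f010(n−2)+4 for all n ≥ 3. Then for every even n ≥ 2, f010(n) = 5·3^(n/2 − 1) − 2. -/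
theorem f010_even_closed_form (f010 : ℕ → ℕ)
    (h0 : f010 0 = 0) (h1 : f010 1 = 1) (h2 : f010 2 = 3)
    (hrec : ∀ n : ℕ, 3 ≤ n → f010 n = 3 * f010 (n - 2) + 4) :
    ∀ n : ℕ, Even n → 2 ≤ n → f010 n = 5 * 3 ^ (n / 2 - 1) - 2 := by
  have key : ∀ k : ℕ, f010 (2 * k + 2) + 2 = 5 * 3 ^ k := by
    intro k
    induction k with
    | zero => simp [h2]
    | succ k ih =>
      rw [hrec _ (by omega), show 2 * (k + 1) + 2 - 2 = 2 * k + 2 by omega, pow_succ]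
      omega
  rintro n hn h
  obtain ⟨k, rfl⟩ : ∃ k, n = 2 * k + 2 := ⟨n / 2 - 1, by grind⟩
  rw [show (2 * k + 2) / 2 - 1 = k by omega, ← key k, Nat.add_sub_cancel]
end

section
/- Let f010, f100 : ℕ → ℕ satisfy f010(0)=0, f010(1)=1, f010(2)=3, f010(n)=3·f010(n−2)+4 for n ≥ 3, together with f100(0)=0, f100(1)=1, and f100(n)=f100(n−2)+2+f010(n−2) for all n ≥ 2. Then for every odd n ≥ 1, f100(n) = (3^((n+1)/2) − 1)/2, i.e. 2·f100(n) = 3^((n+1)/2) − 1. -/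
theorem f010_odd_add_two (f010 : ℕ → ℕ) (h1 : f010 1 = 1)
    (hrec : ∀ n : ℕ, 3 ≤ n → f010 n = 3 * f010 (n - 2) + 4) (k : ℕ) :
    f010 (2 * k + 1) + 2 = 3 ^ (k + 1) := by
  induction k with
  | zero => simp [h1]
  | succ k ih =>
    rw [hrec _ (by omega), show 2 * (k + 1) + 1 - 2 = 2 * k + 1 by omega, pow_succ]
    omega

theorem two_mul_f100_odd_add_one (f010 f100 : ℕ → ℕ) (h010_1 : f010 1 = 1)
    (h010_rec : ∀ n : ℕ, 3 ≤ n → f010 n = 3 * f010 (n - 2) + 4) (h100_1 : f100 1 = 1)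
    (h100_rec : ∀ n : ℕ, 2 ≤ n → f100 n = f100 (n - 2) + 2 + f010 (n - 2)) (k : ℕ) :
    2 * f100 (2 * k + 1) + 1 = 3 ^ (k + 1) := by
  induction k with
  | zero => simp [h100_1]
  | succ k ih =>
    have h := f010_odd_add_two f010 h010_1 h010_rec k
    rw [h100_rec _ (by omega), show 2 * (k + 1) + 1 - 2 = 2 * k + 1 by omega, pow_succ]
    omega

theorem f100_odd_closed_form (f010 f100 : ℕ → ℕ)
    (h010_0 : f010 0 = 0) (h010_1 : f010 1 = 1) (h010_2 : f010 2 = 3)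
    (h010_rec : ∀ n : ℕ, 3 ≤ n → f010 n = 3 * f010 (n - 2) + 4)
    (h100_0 : f100 0 = 0) (h100_1 : f100 1 = 1)
    (h100_rec : ∀ n : ℕ, 2 ≤ n → f100 n = f100 (n - 2) + 2 + f010 (n - 2)) :
    ∀ n : ℕ, Odd n → 1 ≤ n → 2 * f100 n = 3 ^ ((n + 1) / 2) - 1 := by
  rintro _ ⟨k, rfl⟩ -
  have h := two_mul_f100_odd_add_one f010 f100 h010_1 h010_rec h100_1 h100_rec k
  rw [show (2 * k + 1 + 1) / 2 = k + 1 by omega]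
  omega
end

section
/- Let f010, f100 : ℕ → ℕ satisfy f010(0)=0, f010(1)=1, f010(2)=3, f010(n)=3·f010(n−2)+4 for n ≥ 3, together with f100(0)=0, f100(1)=1, and f100(n)=f100(n−2)+2+f010(n−2) for all n ≥ 2. Then for every even n ≥ 2, 2·f100(n) = 5·3^(n/2 − 1) − 1. -/
theorem f100_even_closed_form (f010 f100 : ℕ → ℕ)
    (h010_0 : f010 0 = 0) (h010_1 : f010 1 = 1) (h010_2 : f010 2 = 3)
    (h010_rec : ∀ n : ℕ, 3 ≤ n → f010 n = 3 * f010 (n - 2) + 4)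
    (h100_0 : f100 0 = 0) (h100_1 : f100 1 = 1)
    (h100_rec : ∀ n : ℕ, 2 ≤ n → f100 n = f100 (n - 2) + 2 + f010 (n - 2)) :
    ∀ n : ℕ, Even n → 2 ≤ n → 2 * f100 n = 5 * 3 ^ (n / 2 - 1) - 1 := by
  have key : ∀ k : ℕ, f010 (2 * k + 2) + 2 = 5 * 3 ^ k ∧
      2 * f100 (2 * k + 2) + 1 = 5 * 3 ^ k := by
    intro k
    induction k with
    | zero =>
      have h := h100_rec 2 le_rfl
      norm_num [h100_0, h010_0] at h
      norm_num [h010_2, h]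
    | succ k ih =>
      have h₁ := h010_rec (2 * (k + 1) + 2) (by omega)
      have h₂ := h100_rec (2 * (k + 1) + 2) (by omega)
      have e : 2 * (k + 1) + 2 - 2 = 2 * k + 2 := by omega
      rw [e] at h₁ h₂
      rw [pow_succ]
      omega
  rintro n ⟨m, rfl⟩ hn
  obtain ⟨k, rfl⟩ : ∃ k, m = k + 1 := ⟨m - 1, by omega⟩
  have h := (key k).2
  have e₁ : k + 1 + (k + 1) = 2 * k + 2 := by omega
  have e₂ : (2 * k + 2) / 2 - 1 = k := by omega
  rw [e₁, e₂]
  omega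
end

section
/- Let f010, f100, f000 : ℕ → ℕ satisfy f010(0)=0, f010(1)=1, f010(2)=3, f010(n)=3·f010(n−2)+4 for n ≥ 3; f100(0)=0, f100(1)=1, f100(n)=f100(n−2)+2+f010(n−2) for n ≥ 2; and f000(0)=0, f000(n)=2·f100(n−1)+1 for n ≥ 1. Then for every even n ≥ 2, f000(n) = 3^(n/2). -/
theorem f000_even_closed_form (f010 f100 f000 : ℕ → ℕ)
    (h010_0 : f010 0 = 0) (h010_1 : f010 1 = 1) (h010_2 : f010 2 = 3)
    (h010_rec : ∀ n : ℕ, 3 ≤ n → f010 n = 3 * f010 (n - 2) + 4)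
    (h100_0 : f100 0 = 0) (h100_1 : f100 1 = 1)
    (h100_rec : ∀ n : ℕ, 2 ≤ n → f100 n = f100 (n - 2) + 2 + f010 (n - 2))
    (h000_0 : f000 0 = 0)
    (h000_rec : ∀ n : ℕ, 1 ≤ n → f000 n = 2 * f100 (n - 1) + 1) :
    ∀ n : ℕ, Even n → 2 ≤ n → f000 n = 3 ^ (n / 2) := by
  have odd_values (k : ℕ) :
      f010 (2 * k + 1) + 2 = 3 ^ (k + 1) ∧ 2 * f100 (2 * k + 1) + 1 = 3 ^ (k + 1) := by
    induction k with
    | zero => simp [h010_1, h100_1]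
    | succ k ih =>
      have h010 := h010_rec (2 * (k + 1) + 1) (by omega)
      have h100 := h100_rec (2 * (k + 1) + 1) (by omega)
      rw [show 2 * (k + 1) + 1 - 2 = 2 * k + 1 by omega] at h010 h100
      rw [pow_succ 3 (k + 1)]
      omega
  intro n hn hn2
  obtain ⟨k, rfl⟩ : ∃ k, n = 2 * k + 2 := by
    obtain ⟨m, rfl⟩ := hn
    exact ⟨m - 1, by omega⟩
  rw [h000_rec _ (by omega), show (2 * k + 2) / 2 = k + 1 by omega]
  exact (odd_values k).2
end

section
/- Let f010, f100, f000 : ℕ → ℕ satisfy f010(0)=0, f010(1)=1, f010(2)=3, f010(n)=3·f010(n−2)+4 for n ≥ 3; f100(0)=0, f100(1)=1, f100(n)=f100(n−2)+2+f010(n−2) for n ≥ 2; and f000(0)=0, f000(n)=2·f100(n−1)+1 for n ≥ 1. Then for every odd n ≥ 3, f000(n) = 5·3^((n−3)/2). -/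
theorem f000_odd_closed_form (f010 f100 f000 : ℕ → ℕ)
    (h010_0 : f010 0 = 0) (h010_1 : f010 1 = 1) (h010_2 : f010 2 = 3)
    (h010_rec : ∀ n : ℕ, 3 ≤ n → f010 n = 3 * f010 (n - 2) + 4)
    (h100_0 : f100 0 = 0) (h100_1 : f100 1 = 1)
    (h100_rec : ∀ n : ℕ, 2 ≤ n → f100 n = f100 (n - 2) + 2 + f010 (n - 2))
    (h000_0 : f000 0 = 0)
    (h000_rec : ∀ n : ℕ, 1 ≤ n → f000 n = 2 * f100 (n - 1) + 1) :
    ∀ n : ℕ, Odd n → 3 ≤ n → f000 n = 5 * 3 ^ ((n - 3) / 2) := by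
  have h010 : ∀ k : ℕ, f010 (2 * k + 2) + 2 = 5 * 3 ^ k := by
    intro k
    induction k with
    | zero => simp [h010_2]
    | succ k ih =>
      have h := h010_rec (2 * (k + 1) + 2) (by omega)
      rw [show 2 * (k + 1) + 2 - 2 = 2 * k + 2 by omega] at h
      rw [pow_succ]
      omega
  have h100 : ∀ k : ℕ, 2 * f100 (2 * k + 2) + 1 = 5 * 3 ^ k := by
    intro k
    induction k with
    | zero =>
      have h := h100_rec 2 le_rfl
      simp only [Nat.sub_self, h100_0, h010_0] at h
      simp [h]
    | succ k ih =>
      have h := h100_rec (2 * (k + 1) + 2) (by omega)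
      rw [show 2 * (k + 1) + 2 - 2 = 2 * k + 2 by omega] at h
      have h' := h010 k
      rw [pow_succ]
      omega
  intro n hodd hn
  obtain ⟨k, rfl⟩ : ∃ k, n = 2 * k + 3 := by
    obtain ⟨m, rfl⟩ := hodd
    exact ⟨m - 1, by omega⟩
  rw [h000_rec _ (by omega), show 2 * k + 3 - 1 = 2 * k + 2 by omega,
    show (2 * k + 3 - 3) / 2 = k by omega]
  exact h100 k
end

section
/- Let f010, f100, f000 : ℕ → ℕ satisfy f010(0)=0, f010(1)=1, f010(2)=3, f010(n)=3·f010(n−2)+4 for n ≥ 3; f100(0)=0, f100(1)=1, f100(n)=f100(n−2)+2+f010(n−2) for n ≥ 2; and f000(0)=0, f000(n)=2·f100(n−1)+1 for n ≥ 1. Then f000(n) ≤ 2^n − 1 for all n ≥ 0, and the inequality is strict for all n ≥ 3. -/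
theorem add_two_le_three_mul_two_pow (f : ℕ → ℕ)
    (h0 : f 0 = 0) (h1 : f 1 = 1) (h2 : f 2 = 3)
    (hrec : ∀ n : ℕ, 3 ≤ n → f n = 3 * f (n - 2) + 4) :
    ∀ n : ℕ, f n + 2 ≤ 3 * 2 ^ n
  | 0 => by simp [h0]
  | 1 => by simp [h1]
  | 2 => by simp [h2]
  | n + 3 => by
    have ih := add_two_le_three_mul_two_pow f h0 h1 h2 hrec (n + 1)
    have h := hrec (n + 3) (by omega)
    rw [show n + 3 - 2 = n + 1 by omega] at h
    rw [pow_succ] at ih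
    rw [h, pow_add]
    omega

theorem add_one_lt_two_pow_of_rec (f g : ℕ → ℕ) (hf : ∀ n : ℕ, f n + 2 ≤ 3 * 2 ^ n)
    (h2 : g 2 = 2) (h3 : g 3 = 4)
    (hrec : ∀ n : ℕ, 2 ≤ n → g n = g (n - 2) + 2 + f (n - 2)) :
    ∀ n : ℕ, g (n + 2) + 1 < 2 ^ (n + 2)
  | 0 => by simp [h2]
  | 1 => by simp [h3]
  | n + 2 => by
    have ih := add_one_lt_two_pow_of_rec f g hf h2 h3 hrec n
    have h := hrec (n + 2 + 2) (by omega)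
    rw [show n + 2 + 2 - 2 = n + 2 by omega] at h
    have hb := hf (n + 2)
    rw [h, pow_add 2 (n + 2) 2]
    omega

theorem f000_le_hanoi (f010 f100 f000 : ℕ → ℕ)
    (h010_0 : f010 0 = 0) (h010_1 : f010 1 = 1) (h010_2 : f010 2 = 3)
    (h010_rec : ∀ n : ℕ, 3 ≤ n → f010 n = 3 * f010 (n - 2) + 4)
    (h100_0 : f100 0 = 0) (h100_1 : f100 1 = 1)
    (h100_rec : ∀ n : ℕ, 2 ≤ n → f100 n = f100 (n - 2) + 2 + f010 (n - 2))
    (h000_0 : f000 0 = 0)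
    (h000_rec : ∀ n : ℕ, 1 ≤ n → f000 n = 2 * f100 (n - 1) + 1) :
    (∀ n : ℕ, f000 n ≤ 2 ^ n - 1) ∧ (∀ n : ℕ, 3 ≤ n → f000 n < 2 ^ n - 1) := by
  have hf := add_two_le_three_mul_two_pow f010 h010_0 h010_1 h010_2 h010_rec
  have h2 : f100 2 = 2 := by simp [h100_rec 2 le_rfl, h100_0, h010_0]
  have h3 : f100 3 = 4 := by simp [h100_rec 3 (by omega), h100_1, h010_1]
  have hg := add_one_lt_two_pow_of_rec f010 f100 hf h2 h3 h100_rec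
  have hlt : ∀ n : ℕ, 3 ≤ n → f000 n < 2 ^ n - 1 := by
    intro n hn
    obtain ⟨k, rfl⟩ := Nat.exists_eq_add_of_le' hn
    have h := h000_rec (k + 3) (by omega)
    rw [show k + 3 - 1 = k + 2 by omega] at h
    have hk := hg k
    rw [h, pow_succ 2 (k + 2)]
    omega
  refine ⟨fun n => ?_, hlt⟩
  rcases lt_or_ge n 3 with hn | hn
  · interval_cases n
    · simp [h000_0]
    · simp [h000_rec 1 le_rfl, h100_0]
    · simp [h000_rec 2 (by omega), h100_1]
  · exact (hlt n hn).le
end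

section
/- Let f010, f100, f000 : ℕ → ℕ satisfy f010(0)=0, f010(1)=1, f010(2)=3, f010(n)=3·f010(n−2)+4 for n ≥ 3; f100(0)=0, f100(1)=1, f100(n)=f100(n−2)+2+f010(n−2) for n ≥ 2; and f000(0)=0, f000(n)=2·f100(n−1)+1 for n ≥ 1. Then f100(n) < f000(n) for all n ≥ 2. -/
theorem f100_lt_f000 (f010 f100 f000 : ℕ → ℕ)
    (h010_0 : f010 0 = 0) (h010_1 : f010 1 = 1) (h010_2 : f010 2 = 3)
    (h010_rec : ∀ n : ℕ, 3 ≤ n → f010 n = 3 * f010 (n - 2) + 4)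
    (h100_0 : f100 0 = 0) (h100_1 : f100 1 = 1)
    (h100_rec : ∀ n : ℕ, 2 ≤ n → f100 n = f100 (n - 2) + 2 + f010 (n - 2))
    (h000_0 : f000 0 = 0)
    (h000_rec : ∀ n : ℕ, 1 ≤ n → f000 n = 2 * f100 (n - 1) + 1) :
    ∀ n : ℕ, 2 ≤ n → f100 n < f000 n := by
  have h010 : ∀ n, f010 (n + 2) ≤ 2 * f010 (n + 1) + 2 := by
    intro n
    induction n using Nat.twoStepInduction with
    | zero => simp [h010_1, h010_2]
    | one => simp [h010_rec 3 le_rfl, h010_1, h010_2]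
    | more n ih _ =>
      have h₁ := h010_rec (n + 3) (by omega)
      have h₂ := h010_rec (n + 4) (by omega)
      simp only [Nat.reduceSubDiff] at h₁ h₂
      change f010 (n + 4) ≤ 2 * f010 (n + 3) + 2
      omega
  have h100 : ∀ n, f100 (n + 2) ≤ 2 * f100 (n + 1) := by
    intro n
    induction n using Nat.twoStepInduction with
    | zero => simp [h100_rec 2 le_rfl, h100_0, h100_1, h010_0]
    | one => simp [h100_rec 2 le_rfl, h100_rec 3, h100_0, h100_1, h010_0, h010_1]
    | more n ih _ =>
      have h₁ := h100_rec (n + 3) (by omega)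
      have h₂ := h100_rec (n + 4) (by omega)
      have h₃ := h010 n
      simp only [Nat.reduceSubDiff] at h₁ h₂
      change f100 (n + 4) ≤ 2 * f100 (n + 3)
      omega
  intro n hn
  obtain ⟨k, rfl⟩ := Nat.exists_eq_add_of_le' hn
  rw [h000_rec (k + 2) (by omega)]
  exact Nat.lt_succ_of_le (h100 k)
end

section
/- Let f010 : ℕ → ℕ satisfy f010(0)=0, f010(1)=1, f010(2)=3, and f010(n)=3·f010(n−2)+4 for all n ≥ 3, and let g : ℕ → ℕ satisfy g(1)=1, g(2)=3, and g(n)=4·g(n−2)+3 for all n ≥ 3. Then f010(n) < g(n) for all n ≥ 4. -/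
theorem optimal_lt_naive (f010 g : ℕ → ℕ)
    (h010_0 : f010 0 = 0) (h010_1 : f010 1 = 1) (h010_2 : f010 2 = 3)
    (h010_rec : ∀ n : ℕ, 3 ≤ n → f010 n = 3 * f010 (n - 2) + 4)
    (hg1 : g 1 = 1) (hg2 : g 2 = 3)
    (hg_rec : ∀ n : ℕ, 3 ≤ n → g n = 4 * g (n - 2) + 3) :
    ∀ n : ℕ, 4 ≤ n → f010 n < g n := by
  intro n hn
  induction n using Nat.strong_induction_on with
  | _ n ih =>
    have hf := h010_rec n (by omega)
    have hg := hg_rec n (by omega)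
    obtain rfl | rfl | h : n = 4 ∨ n = 5 ∨ 6 ≤ n := by omega
    · norm_num [h010_2, hg2] at hf hg
      omega
    · have hf3 := h010_rec 3 le_rfl
      have hg3 := hg_rec 3 le_rfl
      norm_num [h010_1, hg1] at hf hg hf3 hg3
      omega
    · have := ih (n - 2) (by omega) (by omega)
      omega
end
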